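/- Let U : [0,1] → ℝ be monotone nondecreasing and convex with max(0, 2s−1) ≤ U(s) ≤ Ubar(s) for all s ∈ [0,1]. Then there exist functions κ : [0,1] → [0,1] and τ : [0,1] → [0,∞) such that the mechanism x(s,y) = κ(s)·1{∏_{k=1}^{n−1} y_k ≥ τ(s)·∏(1−y_k)} satisfies U_x(s;s) = U(s) for all s ∈ [0,1] and U_x(s;s) ≥ U_x(t;s) for all s, t ∈ [0,1]; in particular x is feasible and its indirect utility equals U on [L,R]. -/

import Mathlib

open MeasureTheory Set Filter

noncomputable section

/-- The unit cube `[0,1]^m` inside `Fin m → ℝ`. -/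
def cube (m : ℕ) : Set (Fin m → ℝ) := Set.univ.pi fun _ => Set.Icc (0:ℝ) 1

/-- `w⁺(y) = ∏ y_k · f(y_k)`. -/
def wplus (f : ℝ → ℝ) {m : ℕ} (y : Fin m → ℝ) : ℝ := ∏ k, y k * f (y k)

/-- `w⁻(y) = ∏ (1 - y_k) · f(y_k)`. -/
def wminus (f : ℝ → ℝ) {m : ℕ} (y : Fin m → ℝ) : ℝ := ∏ k, (1 - y k) * f (y k)

/-- Hypotheses on the signal density `f` with derivative `f'` on `[L,R]`. -/
structure Density (f f' : ℝ → ℝ) (L R : ℝ) : Prop where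
  nonneg : ∀ s, 0 ≤ f s
  zero_outside : ∀ s ∉ Set.Icc L R, f s = 0
  pos : ∀ s ∈ Set.Icc L R, 0 < f s
  hderiv : ∀ s ∈ Set.Icc L R, HasDerivWithinAt f (f' s) (Set.Icc L R) s
  cont_deriv : ContinuousOn f' (Set.Icc L R)
  total : (∫ s in L..R, f s) = 1
  mean : (∫ s in L..R, s * f s) = 1 / 2

/-- A mechanism is measurable with values in `[0,1]`. -/
def IsMechanism {m : ℕ} (x : ℝ → (Fin m → ℝ) → ℝ) : Prop :=
  Measurable (Function.uncurry x) ∧ ∀ s y, x s y ∈ Set.Icc (0:ℝ) 1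

/-- `A(t) = ∫_{[0,1]^m} x(t,y) w⁺(y) dy`. -/
def Amap (f : ℝ → ℝ) {m : ℕ} (x : ℝ → (Fin m → ℝ) → ℝ) (t : ℝ) : ℝ :=
  ∫ y in cube m, x t y * wplus f y

/-- `B(t) = ∫_{[0,1]^m} x(t,y) w⁻(y) dy`. -/
def Bmap (f : ℝ → ℝ) {m : ℕ} (x : ℝ → (Fin m → ℝ) → ℝ) (t : ℝ) : ℝ :=
  ∫ y in cube m, x t y * wminus f y

/-- Interim payoff `U_x(t;s) = 2^m (s A(t) - (1-s) B(t))` (with `m = n-1`). -/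
def Upay (f : ℝ → ℝ) {m : ℕ} (x : ℝ → (Fin m → ℝ) → ℝ) (t s : ℝ) : ℝ :=
  2 ^ m * (s * Amap f x t - (1 - s) * Bmap f x t)

/-- Feasibility: mechanism + participation + incentive compatibility on `[L,R]`. -/
def Feasible (f : ℝ → ℝ) (L R : ℝ) {m : ℕ} (x : ℝ → (Fin m → ℝ) → ℝ) : Prop :=
  IsMechanism x ∧ (∀ s ∈ Set.Icc L R, 0 ≤ Upay f x s s) ∧
    (∀ s ∈ Set.Icc L R, ∀ t ∈ Set.Icc L R, Upay f x t s ≤ Upay f x s s)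

/-- The designer's value `V(x)`. -/
def Value (f : ℝ → ℝ) (L R : ℝ) {m : ℕ} (x : ℝ → (Fin m → ℝ) → ℝ) : ℝ :=
  2 ^ m * ∫ s in L..R, (s * Amap f x s + (1 - s) * Bmap f x s) * f s

/-- The first-best utility `Ubar`. -/
def Ubar (f : ℝ → ℝ) (m : ℕ) (s : ℝ) : ℝ :=
  2 ^ m * ∫ y in cube m, max (s * wplus f y - (1 - s) * wminus f y) 0


lemma aux_abs (a b : ℝ → ℝ) (ca : Continuous a) (cb : Continuous b)
    (b0 : ∀ t, 0 ≤ b t) (ha : a 0 = 1) (hb : b 0 = 1)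
    (hab : ∀ t, 0 ≤ t → t * b t ≤ a t) (hlim : Tendsto a atTop (nhds 0))
    (al be : ℝ) (hbe : 0 ≤ be) (hba : be ≤ al)
    (hle : ∀ t, 0 ≤ t → al - t * be ≤ a t - t * b t)
    (T : ℝ) (hT : T = sInf {t | 0 ≤ t ∧ (al / be) * b t ≤ a t}) :
    0 ≤ T ∧ be / b T ∈ Set.Icc (0:ℝ) 1 ∧ be / b T * a T = al ∧ be / b T * b T = be := by
  have T0 : 0 ≤ T := by
    rw [hT]; exact Real.sInf_nonneg (fun x hx => hx.1)
  refine ⟨T0, ?_⟩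
  rcases hbe.eq_or_lt with h0 | hpos
  · have : al ≤ 0 := by
      refine ge_of_tendsto hlim ?_
      filter_upwards [eventually_ge_atTop 0] with t ht
      have := hle t ht
      have := mul_nonneg ht (b0 t)
      subst h0
      linarith
    have : al = 0 := by linarith
    subst h0
    simp [this]
  set r := al / be with hr
  have har : al = r * be := by rw [hr]; field_simp
  have r1 : 1 ≤ r := by rw [hr, le_div_iff₀ hpos]; linarith
  set S := {t | 0 ≤ t ∧ r * b t ≤ a t} with hS
  have hSc : IsClosed S := by
    apply IsClosed.inter
    · exact isClosed_le continuous_const continuous_id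
    · exact isClosed_le (by fun_prop) ca
  have hrS : r ∈ S := ⟨by linarith, hab r (by linarith)⟩
  have hbd : BddBelow S := ⟨0, fun x hx => hx.1⟩
  have hTS : T ∈ S := hT ▸ hSc.csInf_mem ⟨r, hrS⟩ hbd
  have hTr : T ≤ r := hT ▸ csInf_le hbd hrS
  have hlt : ∀ t, 0 ≤ t → t < T → a t < r * b t := by
    intro t h1 h2
    by_contra h
    exact absurd (csInf_le hbd (show t ∈ S from ⟨h1, not_lt.1 h⟩)) (by rw [← hT]; linarith)
  -- limit principle
  have key : ∀ g : ℝ → ℝ, Continuous g → 0 < T → (∀ t, 0 ≤ t → t < T → 0 ≤ g t) → 0 ≤ g T := by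
    intro g cg hT0 hg
    have h1 : Tendsto g (nhdsWithin T (Set.Iio T)) (nhds (g T)) :=
      (cg.tendsto T).mono_left nhdsWithin_le_nhds
    refine ge_of_tendsto h1 ?_
    have : Set.Ioo 0 T ∈ nhdsWithin T (Set.Iio T) := Ioo_mem_nhdsLT hT0
    filter_upwards [this] with t ht
    exact hg t ht.1.le ht.2
  have hzero : a T = r * b T := by
    apply le_antisymm _ hTS.2
    rcases T0.eq_or_lt with h | h
    · rw [← h, ha, hb]; linarith
    · have := key (fun t => r * b t - a t) (by fun_prop) h (fun t h1 h2 => by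
        have := hlt t h1 h2
        linarith)
      linarith
  have step : ∀ t, 0 ≤ t → t < r → a t ≤ r * b t → be ≤ b t := by
    intro t h0 h1 h2
    have h3 := hle t h0
    have : (r - t) * be ≤ (r - t) * b t := by rw [har] at h3; nlinarith
    exact le_of_mul_le_mul_left this (by linarith)
  have hbb : be ≤ b T := by
    rcases hTr.eq_or_lt with h | h
    · have := key (fun t => b t - be) (by fun_prop) (by linarith) (fun t h1 h2 => by
        have := step t h1 (by linarith) (hlt t h1 h2).le
        linarith)
      linarith
    · exact step T T0 h hzero.le
  have hbT : 0 < b T := by linarith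
  refine ⟨⟨by positivity, (div_le_one hbT).2 hbb⟩, ?_, by field_simp⟩
  rw [hzero, har]; field_simp

lemma aux_mono (a b : ℝ → ℝ) (b0 : ∀ t, 0 ≤ b t)
    (hab : ∀ t, 0 ≤ t → t * b t ≤ a t) :
    Monotone (fun r : ℝ => sInf {t | 0 ≤ t ∧ r * b t ≤ a t}) := by
  intro r r' h
  apply csInf_le_csInf
  · exact ⟨0, fun x hx => hx.1⟩
  · refine ⟨max r' 0, le_max_right _ _, ?_⟩
    exact (mul_le_mul_of_nonneg_right (le_max_left _ _) (b0 _)).trans (hab _ (le_max_right _ _))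
  · intro t ht
    exact ⟨ht.1, (mul_le_mul_of_nonneg_right h (b0 _)).trans ht.2⟩

lemma aux_sub (U : ℝ → ℝ)
    (hmono : MonotoneOn U (Set.Icc (0:ℝ) 1))
    (hconv : ConvexOn ℝ (Set.Icc (0:ℝ) 1) U)
    (hlow : ∀ s ∈ Set.Icc (0:ℝ) 1, max 0 (2 * s - 1) ≤ U s)
    (h0 : U 0 ≤ 0) (h1 : U 1 ≤ 1) (s : ℝ) (hs : s ∈ Set.Icc (0:ℝ) 1) :
    ∃ p : ℝ × ℝ, 0 ≤ p.2 ∧ p.2 ≤ p.1 ∧ (∀ t ∈ Set.Icc (0:ℝ) 1, t * p.1 - (1 - t) * p.2 ≤ U t) ∧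
      s * p.1 - (1 - s) * p.2 = U s := by
  have lowa : ∀ s ∈ Set.Icc (0:ℝ) 1, 0 ≤ U s := fun s hs => (le_max_left _ _).trans (hlow s hs)
  have lowb : ∀ s ∈ Set.Icc (0:ℝ) 1, 2 * s - 1 ≤ U s :=
    fun s hs => (le_max_right _ _).trans (hlow s hs)
  rcases hs.1.eq_or_lt with h | hs0
  · subst h
    refine ⟨(0,0), le_rfl, le_rfl, fun t ht => by simpa using lowa t ht, ?_⟩
    have := lowa 0 hs
    simp; linarith
  rcases hs.2.eq_or_lt with h | hs1
  · subst h
    refine ⟨(1,1), by simp, le_rfl, fun t ht => by have := lowb t ht; simp; linarith, ?_⟩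
    have := lowb 1 hs
    simp; linarith
  have hint : s ∈ interior (Set.Icc (0:ℝ) 1) := by rw [interior_Icc]; exact ⟨hs0, hs1⟩
  set p := derivWithin U (Set.Ioi s) s with hp
  have hsub : ∀ t ∈ Set.Icc (0:ℝ) 1, U s + p * (t - s) ≤ U t := by
    intro t ht
    rcases lt_trichotomy t s with h | h | h
    · have h2 := hconv.slope_le_leftDeriv_of_mem_interior ht hint h
      have h3 := hconv.leftDeriv_le_rightDeriv_of_mem_interior hint
      have h4 := h2.trans h3
      rw [slope_def_field, div_le_iff₀ (by linarith)] at h4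
      simp only [← hp] at h4
      linarith
    · subst h; simp
    · have h2 := hconv.rightDeriv_le_slope_of_mem_interior hint ht h
      rw [slope_def_field, le_div_iff₀ (by linarith)] at h2
      simp only [← hp] at h2
      linarith
  have hp0 : 0 ≤ p := by
    by_contra hneg
    push Not at hneg
    have h2 := hsub 0 ⟨le_rfl, zero_le_one⟩
    have h3 := hmono ⟨le_rfl, zero_le_one⟩ hs hs.1
    nlinarith
  have e0 := hsub 0 ⟨le_rfl, zero_le_one⟩
  have e1 := hsub 1 ⟨zero_le_one, le_rfl⟩
  refine ⟨(U s + p * (1 - s), -(U s + p * (0 - s))), by simp only; linarith, ?_, ?_, ?_⟩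
  · simp only
    rcases le_total s (1/2) with h | h
    · have := lowa s hs
      nlinarith
    · have := lowb s hs
      have h5 : p * (1 - s) ≤ 2 * (1 - s) := by linarith
      have h6 : p ≤ 2 := le_of_mul_le_mul_right h5 (by linarith)
      nlinarith
  · intro t ht
    have := hsub t ht
    simp only; nlinarith
  · simp only; ring

lemma aux_null (k : ℕ) (τ : ℝ) :
    ∀ᵐ y : Fin (k+1) → ℝ, τ * ∏ i, (1 - y i) ≠ ∏ i, y i := by
  have hmp := (volume_preserving_piFinSuccAbove (fun _ : Fin (k+1) => ℝ) 0)
  set S : Set (ℝ × (Fin k → ℝ)) :=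
    {z | τ * ((1 - z.1) * ∏ i, (1 - z.2 i)) = z.1 * ∏ i, z.2 i} with hS
  have hSm : MeasurableSet S := by
    apply measurableSet_eq_fun <;> fun_prop
  have hS0 : volume S = 0 := by
    rw [Measure.volume_eq_prod, Measure.prod_apply_symm hSm]
    rw [lintegral_eq_zero_iff (measurable_measure_prodMk_right hSm)]
    have : ∀ᵐ z : Fin k → ℝ, ∀ i, z i ≠ 0 := by
      rw [ae_all_iff]; intro i
      exact Measure.ae_eval_ne (fun _ => volume) i 0
    filter_upwards [this] with z hz
    have hP : ∏ i, z i ≠ 0 := Finset.prod_ne_zero_iff.2 (fun i _ => hz i)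
    have : ((fun x => (x, z)) ⁻¹' S).Subsingleton := by
      intro x hx x' hx'
      simp only [hS, Set.mem_preimage, Set.mem_ofPred_eq] at hx hx'
      set P := ∏ i, z i
      set Q := ∏ i, (1 - z i)
      by_contra hne
      have hd : (x - x') * (P + τ * Q) = 0 := by linarith
      have : P + τ * Q = 0 := by
        rcases mul_eq_zero.1 hd with h | h
        · exact absurd (sub_eq_zero.1 h) hne
        · exact h
      have : P = 0 := by
        have : τ * Q = -P := by linarith
        have h1 : τ * ((1 - x) * Q) = (1 - x) * (τ * Q) := by ring
        rw [h1, this] at hx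
        linarith
      exact hP this
    exact this.measure_zero _
  have := hmp.measure_preimage hSm.nullMeasurableSet
  rw [hS0] at this
  rw [ae_iff]
  convert this using 2
  ext y
  simp only [hS, Fin.prod_univ_succ, ne_eq, not_not, Set.mem_ofPred_eq, Set.mem_preimage,
    MeasurableEquiv.piFinSuccAbove_apply]
  simp [Fin.insertNthEquiv, Fin.tail]

def ind {m : ℕ} (τ : ℝ) (y : Fin m → ℝ) : ℝ :=
  if τ * ∏ k, (1 - y k) ≤ ∏ k, y k then 1 else 0

lemma ind_nonneg {m : ℕ} (τ : ℝ) (y : Fin m → ℝ) : 0 ≤ ind τ y := by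
  unfold ind; split_ifs <;> simp

lemma ind_le {m : ℕ} (τ : ℝ) (y : Fin m → ℝ) : ind τ y ≤ 1 := by
  unfold ind; split_ifs <;> simp

lemma ind_meas {m : ℕ} (τ : ℝ) : Measurable (ind τ : (Fin m → ℝ) → ℝ) := by
  unfold ind
  refine Measurable.ite (measurableSet_le ?_ ?_) ?_ ?_ <;> fun_prop

lemma ind_int {m : ℕ} (τ : ℝ) (w : (Fin m → ℝ) → ℝ) (hw : IntegrableOn w (cube m)) :
    IntegrableOn (fun y => ind τ y * w y) (cube m) := by
  refine Integrable.bdd_mul hw (ind_meas τ).aestronglyMeasurable (c := 1) ?_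
  filter_upwards with y
  rw [Real.norm_eq_abs, abs_of_nonneg (ind_nonneg _ _)]
  exact ind_le _ _

lemma ind_norm {m : ℕ} (τ : ℝ) (y : Fin m → ℝ) (c : ℝ) : ‖ind τ y * c‖ ≤ ‖c‖ := by
  rw [norm_mul, Real.norm_eq_abs, abs_of_nonneg (ind_nonneg _ _)]
  exact mul_le_of_le_one_left (norm_nonneg _) (ind_le _ _)

lemma ind_cont (k : ℕ) (w : (Fin (k+1) → ℝ) → ℝ) (hw : IntegrableOn w (cube (k+1))) :
    Continuous (fun τ => ∫ y in cube (k+1), ind τ y * w y) := by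
  rw [continuous_iff_continuousAt]
  intro τ
  refine continuousAt_of_dominated (bound := fun y => ‖w y‖) ?_ ?_ hw.norm ?_
  · filter_upwards with t
    exact (ind_int t w hw).aestronglyMeasurable
  · filter_upwards with t
    filter_upwards with y
    exact ind_norm _ _ _
  · filter_upwards [ae_restrict_of_ae (aux_null k τ)] with y hy
    refine ContinuousAt.mul ?_ continuousAt_const
    have c1 : ContinuousAt (fun t : ℝ => t * ∏ i, (1 - y i)) τ := by fun_prop
    rcases lt_or_gt_of_ne hy with h | h
    · have : ∀ᶠ t in nhds τ, t * ∏ i, (1 - y i) < ∏ i, y i :=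
        c1.eventually (gt_mem_nhds h)
      refine (continuousAt_const (y := (1:ℝ))).congr ?_
      filter_upwards [this] with t ht
      simp [ind, ht.le]
    · have : ∀ᶠ t in nhds τ, ∏ i, y i < t * ∏ i, (1 - y i) :=
        c1.eventually (lt_mem_nhds h)
      refine (continuousAt_const (y := (0:ℝ))).congr ?_
      filter_upwards [this] with t ht
      simp [ind, not_le.2 ht]

lemma cube_meas (m : ℕ) : MeasurableSet (cube m) :=
  MeasurableSet.univ_pi (fun _ => measurableSet_Icc)

lemma ind_lim (k : ℕ) (w : (Fin (k+1) → ℝ) → ℝ) (hw : IntegrableOn w (cube (k+1))) :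
    Tendsto (fun τ => ∫ y in cube (k+1), ind τ y * w y) atTop (nhds 0) := by
  have h0 : (0:ℝ) = ∫ y in cube (k+1), (0:ℝ) := by simp
  rw [h0]
  refine tendsto_integral_filter_of_dominated_convergence (bound := fun y => ‖w y‖) ?_ ?_ hw.norm ?_
  · filter_upwards with t
    exact (ind_int t w hw).aestronglyMeasurable
  · filter_upwards with t
    filter_upwards with y
    exact ind_norm _ _ _
  · have hne : ∀ᵐ z : Fin (k+1) → ℝ, ∀ i, z i ≠ 1 := by
      rw [ae_all_iff]; intro i
      exact Measure.ae_eval_ne (fun _ => volume) i 1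
    filter_upwards [ae_restrict_of_ae hne, ae_restrict_mem (cube_meas _)] with y hy hc
    have hq : 0 < ∏ i, (1 - y i) := Finset.prod_pos (fun i _ => by
      have := (hc i (Set.mem_univ _)).2
      have := lt_of_le_of_ne this (hy i)
      linarith)
    refine tendsto_const_nhds.congr' ?_
    filter_upwards [(tendsto_id.atTop_mul_const hq).eventually_gt_atTop (∏ i, y i)] with t ht
    simp only [id] at ht
    simp [ind, not_le.2 ht]

lemma prod_cube (f g : ℝ → ℝ) (m : ℕ) :
    ∫ y in cube m, ∏ k, g (y k) = (∫ s in Set.Icc (0:ℝ) 1, g s) ^ m := by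
  unfold cube
  rw [volume_pi, Measure.restrict_pi_pi, integral_fintype_prod_eq_pow, Fintype.card_fin]

lemma prod_cube_int (g : ℝ → ℝ) (m : ℕ) (hg : IntegrableOn g (Set.Icc (0:ℝ) 1)) :
    IntegrableOn (fun y : Fin m → ℝ => ∏ k, g (y k)) (cube m) := by
  unfold cube IntegrableOn
  rw [volume_pi, Measure.restrict_pi_pi]
  exact Integrable.fintype_prod (fun _ => hg)

section dens
variable {f f' : ℝ → ℝ} {L R : ℝ}

lemma dens_eq (hf : Density f f' L R) (hL : 0 ≤ L) (hLR : L < R) (hR : R ≤ 1) (h : ℝ → ℝ) :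
    ∫ s in Set.Icc (0:ℝ) 1, h s * f s = ∫ s in L..R, h s * f s := by
  rw [intervalIntegral.integral_of_le hLR.le, ← integral_Icc_eq_integral_Ioc]
  refine setIntegral_eq_of_subset_of_forall_sdiff_eq_zero measurableSet_Icc
    (Set.Icc_subset_Icc hL hR) ?_
  intro s hs
  rw [hf.zero_outside s hs.2, mul_zero]

lemma dens_cont (hf : Density f f' L R) : ContinuousOn f (Set.Icc L R) :=
  fun s hs => (hf.hderiv s hs).continuousWithinAt

lemma dens_int (hf : Density f f' L R) (hL : 0 ≤ L) (hR : R ≤ 1)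
    (h : ℝ → ℝ) (hh : Continuous h) :
    IntegrableOn (fun s => h s * f s) (Set.Icc (0:ℝ) 1) := by
  have h1 : IntegrableOn (fun s => h s * f s) (Set.Icc L R) :=
    (hh.continuousOn.mul (dens_cont hf)).integrableOn_Icc
  refine h1.of_forall_sdiff_eq_zero measurableSet_Icc ?_
  intro s hs
  rw [hf.zero_outside s hs.2, mul_zero]

lemma wplus_int (hf : Density f f' L R) (hL : 0 ≤ L) (hR : R ≤ 1) (m : ℕ) :
    IntegrableOn (wplus f (m := m)) (cube m) :=
  prod_cube_int (fun s => s * f s) m (dens_int hf hL hR (fun s => s) continuous_id)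

lemma wminus_int (hf : Density f f' L R) (hL : 0 ≤ L) (hR : R ≤ 1) (m : ℕ) :
    IntegrableOn (wminus f (m := m)) (cube m) :=
  prod_cube_int (fun s => (1 - s) * f s) m
    (dens_int hf hL hR (fun s => 1 - s) (by fun_prop))

lemma wplus_total (hf : Density f f' L R) (hL : 0 ≤ L) (hLR : L < R) (hR : R ≤ 1) (m : ℕ) :
    2 ^ m * ∫ y in cube m, wplus f y = 1 := by
  have := prod_cube f (fun s => s * f s) m
  rw [dens_eq hf hL hLR hR (fun s => s), hf.mean] at this
  unfold wplus
  rw [this, ← mul_pow]; norm_num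

lemma wminus_total (hf : Density f f' L R) (hL : 0 ≤ L) (hLR : L < R) (hR : R ≤ 1) (m : ℕ) :
    2 ^ m * ∫ y in cube m, wminus f y = 1 := by
  have := prod_cube f (fun s => (1 - s) * f s) m
  have i1 : IntervalIntegrable f volume L R :=
    ContinuousOn.intervalIntegrable_of_Icc hLR.le (dens_cont hf)
  have i2 : IntervalIntegrable (fun s => s * f s) volume L R :=
    ContinuousOn.intervalIntegrable_of_Icc hLR.le (continuousOn_id.mul (dens_cont hf))
  have e : ∫ s in L..R, (1 - s) * f s = 1 / 2 := by
    simp_rw [sub_mul, one_mul]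
    rw [intervalIntegral.integral_sub i1 i2, hf.total, hf.mean]; norm_num
  rw [dens_eq hf hL hLR hR (fun s => 1 - s), e] at this
  unfold wminus
  rw [this, ← mul_pow]; norm_num

lemma wplus_eq (f : ℝ → ℝ) {m : ℕ} (y : Fin m → ℝ) :
    wplus f y = (∏ k, y k) * ∏ k, f (y k) := Finset.prod_mul_distrib
lemma wminus_eq (f : ℝ → ℝ) {m : ℕ} (y : Fin m → ℝ) :
    wminus f y = (∏ k, (1 - y k)) * ∏ k, f (y k) := Finset.prod_mul_distrib

lemma ind_max (hf : Density f f' L R) {m : ℕ} (τ : ℝ) (y : Fin m → ℝ) :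
    max (wplus f y - τ * wminus f y) 0 = ind τ y * wplus f y - τ * (ind τ y * wminus f y) := by
  have hF : 0 ≤ ∏ k, f (y k) := Finset.prod_nonneg (fun k _ => hf.nonneg _)
  rw [wplus_eq, wminus_eq]
  unfold ind
  split_ifs with h
  · rw [max_eq_left]; · ring
    have := mul_le_mul_of_nonneg_right h hF
    linarith
  · rw [max_eq_right]; · ring
    have := mul_le_mul_of_nonneg_right (not_le.1 h).le hF
    linarith

lemma ind_maxint (hf : Density f f' L R) (hL : 0 ≤ L) (hR : R ≤ 1) (m : ℕ) (τ : ℝ) :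
    ∫ y in cube m, max (wplus f y - τ * wminus f y) 0 =
      (∫ y in cube m, ind τ y * wplus f y) - τ * ∫ y in cube m, ind τ y * wminus f y := by
  simp_rw [ind_max hf]
  rw [integral_sub (ind_int τ _ (wplus_int hf hL hR m))
    ((ind_int τ _ (wminus_int hf hL hR m)).const_mul τ), integral_const_mul]

lemma Ubar_eq (hf : Density f f' L R) (hL : 0 ≤ L) (hR : R ≤ 1) (m : ℕ) (τ : ℝ) (hτ : 0 ≤ τ) :
    (1 + τ) * Ubar f m (1 / (1 + τ)) =
      2 ^ m * (∫ y in cube m, ind τ y * wplus f y)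
        - τ * (2 ^ m * ∫ y in cube m, ind τ y * wminus f y) := by
  have hp : 0 < 1 + τ := by linarith
  have e : ∀ y : Fin m → ℝ, max (1 / (1 + τ) * wplus f y - (1 - 1 / (1 + τ)) * wminus f y) 0
      = 1 / (1 + τ) * max (wplus f y - τ * wminus f y) 0 := by
    intro y
    rw [mul_max_of_nonneg _ _ (by positivity), mul_zero]
    congr 1
    field_simp
    ring
  unfold Ubar
  simp_rw [e]
  rw [integral_const_mul, ind_maxint hf hL hR]
  field_simp

lemma wminus_nonneg (hf : Density f f' L R) {m : ℕ} (y : Fin m → ℝ) (hy : y ∈ cube m) :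
    0 ≤ wminus f y :=
  Finset.prod_nonneg (fun k _ => mul_nonneg (by have := (hy k (Set.mem_univ _)).2; linarith)
    (hf.nonneg _))

lemma wplus_nonneg (hf : Density f f' L R) {m : ℕ} (y : Fin m → ℝ) (hy : y ∈ cube m) :
    0 ≤ wplus f y :=
  Finset.prod_nonneg (fun k _ => mul_nonneg ((hy k (Set.mem_univ _)).1)
    (hf.nonneg _))

lemma Ubar_zero (hf : Density f f' L R) (m : ℕ) : Ubar f m 0 = 0 := by
  unfold Ubar
  rw [setIntegral_congr_fun (g := fun _ => (0:ℝ)) (cube_meas m)]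
  · simp
  · intro y hy
    have := wminus_nonneg hf y hy
    simp [this]

lemma Ubar_one (hf : Density f f' L R) (hL : 0 ≤ L) (hLR : L < R) (hR : R ≤ 1) (m : ℕ) :
    Ubar f m 1 = 1 := by
  refine Eq.trans ?_ (wplus_total hf hL hLR hR m)
  unfold Ubar
  congr 1
  refine setIntegral_congr_fun (cube_meas m) ?_
  intro y hy
  have := wplus_nonneg hf y hy
  simp [this]

lemma ind_zero {m : ℕ} (w : (Fin m → ℝ) → ℝ) :
    ∫ y in cube m, ind 0 y * w y = ∫ y in cube m, w y := by
  refine setIntegral_congr_fun (cube_meas m) ?_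
  intro y hy
  have : 0 ≤ ∏ k, y k := Finset.prod_nonneg (fun k _ => (hy k (Set.mem_univ _)).1)
  simp [ind, this]

end dens

theorem stmt11 (n : ℕ) (hn : 2 ≤ n) (L R : ℝ) (hL : 0 ≤ L) (hLR : L < R) (hR : R ≤ 1)
    (f f' : ℝ → ℝ) (hf : Density f f' L R)
    (U : ℝ → ℝ)
    (hmono : MonotoneOn U (Set.Icc (0:ℝ) 1))
    (hconv : ConvexOn ℝ (Set.Icc (0:ℝ) 1) U)
    (hbounds : ∀ s ∈ Set.Icc (0:ℝ) 1, max 0 (2 * s - 1) ≤ U s ∧ U s ≤ Ubar f (n - 1) s) :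
    ∃ κ τ : ℝ → ℝ, ∃ x : ℝ → (Fin (n - 1) → ℝ) → ℝ,
      (∀ s ∈ Set.Icc (0:ℝ) 1, κ s ∈ Set.Icc (0:ℝ) 1 ∧ 0 ≤ τ s) ∧
      (∀ (s : ℝ) (y : Fin (n - 1) → ℝ),
        x s y = if τ s * ∏ k, (1 - y k) ≤ ∏ k, y k then κ s else 0) ∧
      (∀ s ∈ Set.Icc (0:ℝ) 1, Upay f x s s = U s) ∧
      (∀ s ∈ Set.Icc (0:ℝ) 1, ∀ t ∈ Set.Icc (0:ℝ) 1, Upay f x t s ≤ Upay f x s s) ∧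
      Feasible f L R x := by
  obtain ⟨k, rfl⟩ : ∃ k, n = k + 2 := ⟨n - 2, by omega⟩
  simp only [show k + 2 - 1 = k + 1 from rfl] at *
  set a : ℝ → ℝ := fun τ => 2 ^ (k+1) * ∫ y in cube (k+1), ind τ y * wplus f y with hadef
  set b : ℝ → ℝ := fun τ => 2 ^ (k+1) * ∫ y in cube (k+1), ind τ y * wminus f y with hbdef
  have ca : Continuous a := continuous_const.mul (ind_cont k _ (wplus_int hf hL hR _))
  have cb : Continuous b := continuous_const.mul (ind_cont k _ (wminus_int hf hL hR _))
  have b0 : ∀ t, 0 ≤ b t := fun t => mul_nonneg (by positivity)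
    (setIntegral_nonneg (cube_meas _) (fun y hy =>
      mul_nonneg (ind_nonneg _ _) (wminus_nonneg hf y hy)))
  have ha1 : a 0 = 1 := by
    simp only [hadef]; rw [ind_zero, wplus_total hf hL hLR hR]
  have hb1 : b 0 = 1 := by
    simp only [hbdef]; rw [ind_zero, wminus_total hf hL hLR hR]
  have hUb : ∀ τ, 0 ≤ τ → (1 + τ) * Ubar f (k+1) (1 / (1 + τ)) = a τ - τ * b τ :=
    fun τ hτ => Ubar_eq hf hL hR (k+1) τ hτ
  have hab : ∀ t, 0 ≤ t → t * b t ≤ a t := by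
    intro t ht
    have h1 := hUb t ht
    have h2 : 0 ≤ Ubar f (k+1) (1 / (1 + t)) :=
      mul_nonneg (by positivity) (integral_nonneg (fun y => le_max_right _ _))
    have := mul_nonneg (by linarith : 0 ≤ 1 + t) h2
    linarith
  have hlim : Tendsto a atTop (nhds 0) := by
    have := (ind_lim k _ (wplus_int hf hL hR (k+1))).const_mul (2 ^ (k+1))
    simpa using this
  have hsub := aux_sub U hmono hconv (fun s hs => (hbounds s hs).1)
    ((hbounds 0 (by simp)).2.trans (Ubar_zero hf _).le)
    ((hbounds 1 (by simp)).2.trans (Ubar_one hf hL hLR hR _).le)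
  choose! P hP1 hP2 hP3 hP4 using hsub
  have pm : ∀ s ∈ Set.Icc (0:ℝ) 1, ∀ t ∈ Set.Icc (0:ℝ) 1, s ≤ t →
      (P s).1 ≤ (P t).1 ∧ (P s).2 ≤ (P t).2 := by
    intro s hs t ht hst
    rcases hst.eq_or_lt with h | h
    · subst h; simp
    have e1 := hP3 s hs t ht
    have e2 := hP3 t ht s hs
    rw [← hP4 t ht] at e1
    rw [← hP4 s hs] at e2
    set da := (P t).1 - (P s).1 with hda
    set db := (P t).2 - (P s).2 with hdb
    have f1 : (1 - t) * db ≤ t * da := by rw [hda, hdb]; linarith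
    have f2 : s * da ≤ (1 - s) * db := by rw [hda, hdb]; linarith
    have h3 : 0 ≤ (t - s) * da := by
      have := mul_le_mul_of_nonneg_left f1 (by linarith [hs.2] : 0 ≤ 1 - s)
      have := mul_le_mul_of_nonneg_left f2 (by linarith [ht.2] : 0 ≤ 1 - t)
      linarith
    have h4 : 0 ≤ (t - s) * db := by
      have := mul_le_mul_of_nonneg_left f1 hs.1
      have := mul_le_mul_of_nonneg_left f2 ht.1
      linarith
    have h5 := nonneg_of_mul_nonneg_right h3 (by linarith)
    have h6 := nonneg_of_mul_nonneg_right h4 (by linarith)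
    exact ⟨by linarith, by linarith⟩
  set c : ℝ → ℝ := fun s => max 0 (min 1 s) with hc
  have hcI : ∀ s, c s ∈ Set.Icc (0:ℝ) 1 := fun s =>
    ⟨le_max_left _ _, max_le zero_le_one (min_le_left _ _)⟩
  have hcm : Monotone c := fun s t h => max_le_max le_rfl (min_le_min le_rfl h)
  have hce : ∀ s ∈ Set.Icc (0:ℝ) 1, c s = s := fun s hs => by
    simp [hc, hs.1, hs.2]
  set al : ℝ → ℝ := fun s => (P (c s)).1 with hal
  set be : ℝ → ℝ := fun s => (P (c s)).2 with hbe
  have mal : Measurable al :=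
    Monotone.measurable (fun s t h => (pm _ (hcI s) _ (hcI t) (hcm h)).1)
  have mbe : Measurable be :=
    Monotone.measurable (fun s t h => (pm _ (hcI s) _ (hcI t) (hcm h)).2)
  set T : ℝ → ℝ := fun r => sInf {t | 0 ≤ t ∧ r * b t ≤ a t} with hT
  have mT : Measurable T := (aux_mono a b b0 hab).measurable
  set τ : ℝ → ℝ := fun s => T (al s / be s) with hτ
  have mτ : Measurable τ := mT.comp (mal.div mbe)
  set κ : ℝ → ℝ := fun s => be s / b (τ s) with hκ
  have mκ : Measurable κ := mbe.div (cb.measurable.comp mτ)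
  have hle : ∀ s, ∀ t, 0 ≤ t → al s - t * be s ≤ a t - t * b t := by
    intro s t ht
    have hpos : 0 < 1 + t := by linarith
    have hm : 1 / (1 + t) ∈ Set.Icc (0:ℝ) 1 := by
      refine ⟨by positivity, ?_⟩
      rw [div_le_one hpos]; linarith
    have h1 := (hP3 (c s) (hcI s) _ hm).trans (hbounds _ hm).2
    rw [← hUb t ht]
    have h2 := mul_le_mul_of_nonneg_left h1 hpos.le
    refine le_trans (le_of_eq ?_) h2
    simp only [hal, hbe]
    field_simp
    ring
  have main : ∀ s, 0 ≤ τ s ∧ κ s ∈ Set.Icc (0:ℝ) 1 ∧ κ s * a (τ s) = al s ∧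
      κ s * b (τ s) = be s := fun s =>
    aux_abs a b ca cb b0 ha1 hb1 hab hlim (al s) (be s) (hP1 _ (hcI s)) (hP2 _ (hcI s))
      (hle s) (τ s) rfl
  set x : ℝ → (Fin (k+1) → ℝ) → ℝ :=
    fun s y => if τ s * ∏ k, (1 - y k) ≤ ∏ k, y k then κ s else 0 with hx
  have hxi : ∀ s y, x s y = κ s * ind (τ s) y := by
    intro s y; simp only [hx, ind]; split_ifs <;> simp
  have pay : ∀ t s, Upay f x t s = s * al t - (1 - s) * be t := by
    intro t s
    unfold Upay Amap Bmap
    simp_rw [hxi, mul_assoc]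
    rw [integral_const_mul, integral_const_mul, ← (main t).2.2.1, ← (main t).2.2.2]
    simp only [hadef, hbdef]
    ring
  have eqU : ∀ s ∈ Set.Icc (0:ℝ) 1, Upay f x s s = U s := by
    intro s hs
    rw [pay]; simp only [hal, hbe, hce s hs]; exact hP4 s hs
  have ic : ∀ s ∈ Set.Icc (0:ℝ) 1, ∀ t ∈ Set.Icc (0:ℝ) 1, Upay f x t s ≤ Upay f x s s := by
    intro s hs t ht
    rw [eqU s hs, pay]; exact hP3 _ (hcI t) s hs
  have hsb : Set.Icc L R ⊆ Set.Icc (0:ℝ) 1 := Set.Icc_subset_Icc hL hR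
  refine ⟨κ, τ, x, fun s _ => ⟨(main s).2.1, (main s).1⟩, fun s y => rfl, eqU, ic, ⟨?_, ?_⟩, ?_, ?_⟩
  · have : Function.uncurry x = fun p : ℝ × (Fin (k+1) → ℝ) =>
        if τ p.1 * ∏ k, (1 - p.2 k) ≤ ∏ k, p.2 k then κ p.1 else 0 := by
      ext p; rfl
    rw [this]
    refine Measurable.ite (measurableSet_le ?_ ?_) ?_ ?_ <;> fun_prop
  · intro s y
    simp only [hx]
    split_ifs
    · exact (main s).2.1
    · simp
  · intro s hs
    rw [eqU s (hsb hs)]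
    exact (le_max_left _ _).trans (hbounds s (hsb hs)).1
  · intro s hs t ht
    exact ic s (hsb hs) t (hsb ht)
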